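/- Area formula for convex cyclic polygons: let n ≥ 1 and let Q₀, Q₁, …, Q_{n+1} be n+2 distinct points in the Euclidean plane ℝ² lying in this cyclic order on a common circle and in convex position, and let A be the area of the convex polygon P_n with these vertices (the 2-dimensional Lebesgue measure of the convex hull of {Q₀, …, Q_{n+1}}). For j = 1, …, n let T_j be the triangle Q₀ Q_j Q_{j+1} with semiperimeter p_j, and set s_j = p_j − dist(Q_j, Q_{j+1}), r_j = p_j − dist(Q₀, Q_{j+1}), t_j = p_j − dist(Q₀, Q_j). Then A² = (p₁·r₁ + Σ_{q=2}^{n} r_q·s_q·∏_{m=2}^{q−1} (s_m/p_m)) · (s₁·t₁ + Σ_{q=2}^{n} p_q·t_q·∏_{m=2}^{q−1} (p_m/s_m)), where empty sums are 0 and empty products are 1. -/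

import Mathlib

open Real EuclideanGeometry Metric MeasureTheory

/-- Twice the signed area of the triangle `a b c`. -/
def orient (a b c : EuclideanSpace ℝ (Fin 2)) : ℝ :=
  (b 0 - a 0) * (c 1 - a 1) - (b 1 - a 1) * (c 0 - a 0)

theorem volume_prod_unit_triangle :
    volume {x : ℝ × ℝ | 0 ≤ x.1 ∧ 0 ≤ x.2 ∧ x.1 + x.2 ≤ 1} = ENNReal.ofReal (1 / 2) := by
  have hmeas : MeasurableSet {x : ℝ × ℝ | 0 ≤ x.1 ∧ 0 ≤ x.2 ∧ x.1 + x.2 ≤ 1} := by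
    measurability
  rw [Measure.volume_eq_prod, Measure.prod_apply hmeas]
  have hsec : ∀ x : ℝ,
      volume (Prod.mk x ⁻¹' {x : ℝ × ℝ | 0 ≤ x.1 ∧ 0 ≤ x.2 ∧ x.1 + x.2 ≤ 1})
        = (Set.Icc (0 : ℝ) 1).indicator (fun x => ENNReal.ofReal (1 - x)) x := by
    intro x
    by_cases hx : x ∈ Set.Icc (0 : ℝ) 1
    · rw [Set.indicator_of_mem hx]
      have : Prod.mk x ⁻¹' {x : ℝ × ℝ | 0 ≤ x.1 ∧ 0 ≤ x.2 ∧ x.1 + x.2 ≤ 1}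
          = Set.Icc 0 (1 - x) := by
        ext y
        simp only [Set.mem_preimage, Set.mem_ofPred_eq, Set.mem_Icc]
        exact ⟨fun h => ⟨h.2.1, by linarith [h.2.2]⟩, fun h => ⟨hx.1, h.1, by linarith [h.2]⟩⟩
      rw [this, Real.volume_Icc, sub_zero]
    · rw [Set.indicator_of_notMem hx]
      have : Prod.mk x ⁻¹' {x : ℝ × ℝ | 0 ≤ x.1 ∧ 0 ≤ x.2 ∧ x.1 + x.2 ≤ 1} = ∅ := by
        ext y
        simp only [Set.mem_preimage, Set.mem_ofPred_eq, Set.mem_empty_iff_false, iff_false]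
        exact fun h => hx ⟨h.1, by linarith [h.2.1, h.2.2]⟩
      rw [this, measure_empty]
  simp_rw [hsec]
  rw [lintegral_indicator measurableSet_Icc, ← ofReal_integral_eq_lintegral_ofReal,
    integral_Icc_eq_integral_Ioc, ← intervalIntegral.integral_of_le zero_le_one]
  · rw [intervalIntegral.integral_sub (by simp) (by simp)]
    norm_num
  · exact (Continuous.integrableOn_Icc (by fun_prop))
  · exact (ae_restrict_iff' measurableSet_Icc).2 (.of_forall fun x hx => by
      simpa using hx.2)

theorem volume_unit_triangle :
    volume {x : EuclideanSpace ℝ (Fin 2) | 0 ≤ x 0 ∧ 0 ≤ x 1 ∧ x 0 + x 1 ≤ 1}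
      = ENNReal.ofReal (1 / 2) := by
  have hmeas : MeasurableSet {x : ℝ × ℝ | 0 ≤ x.1 ∧ 0 ≤ x.2 ∧ x.1 + x.2 ≤ 1} := by
    measurability
  have h := ((volume_preserving_finTwoArrow ℝ).comp
    (PiLp.volume_preserving_ofLp (Fin 2))).measure_preimage hmeas.nullMeasurableSet
  rw [volume_prod_unit_triangle] at h
  exact h

theorem convexHull_triangle_eq_image (a b c : EuclideanSpace ℝ (Fin 2)) :
    convexHull ℝ {a, b, c} = (fun x : EuclideanSpace ℝ (Fin 2) => a + x) ''
      (Matrix.toLpLin 2 2 !![b 0 - a 0, c 0 - a 0; b 1 - a 1, c 1 - a 1] ''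
        {x | 0 ≤ x 0 ∧ 0 ≤ x 1 ∧ x 0 + x 1 ≤ 1}) := by
  have hf : ∀ x : EuclideanSpace ℝ (Fin 2),
      a + Matrix.toLpLin 2 2 !![b 0 - a 0, c 0 - a 0; b 1 - a 1, c 1 - a 1] x
        = (1 - x 0 - x 1) • a + (x 0 • b + x 1 • c) := by
    intro x
    ext i
    fin_cases i <;> simp [Matrix.toLpLin_apply, dotProduct, Fin.sum_univ_two] <;>
      ring
  rw [Set.image_image]
  simp_rw [hf]
  apply Set.Subset.antisymm
  · intro x hx
    rw [convexHull_insert (by simp), convexHull_pair, mem_convexJoin] at hx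
    obtain ⟨_, rfl, _, ⟨u, v, hu, hv, huv, rfl⟩, ⟨k, l, hk, hl, hkl, rfl⟩⟩ := hx
    refine ⟨!₂[l * u, l * v], ⟨by simp; positivity, by simp; positivity, ?_⟩, ?_⟩
    · have : l * u + l * v = l := by rw [← mul_add, huv, mul_one]
      simp only [Matrix.cons_val_zero, Matrix.cons_val_one]
      linarith
    · have : 1 - l * u - l * v = k := by
        have : l * u + l * v = l := by rw [← mul_add, huv, mul_one]
        linarith
      simp [this, smul_smul]
  · rintro _ ⟨x, ⟨h0, h1, h2⟩, rfl⟩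
    have ha : a ∈ convexHull ℝ {a, b, c} := subset_convexHull ℝ _ (by simp)
    have hb : b ∈ convexHull ℝ {a, b, c} := subset_convexHull ℝ _ (by simp)
    have hc : c ∈ convexHull ℝ {a, b, c} := subset_convexHull ℝ _ (by simp)
    have := (convex_convexHull ℝ {a, b, c}).sum_mem (t := Finset.univ)
      (w := ![1 - x 0 - x 1, x 0, x 1]) (z := ![a, b, c])
      (by intro i _; fin_cases i <;> simp <;> linarith)
      (by simp [Fin.sum_univ_three]; ring)
      (by intro i _; fin_cases i <;> assumption)
    simpa [Fin.sum_univ_three, add_assoc] using this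

theorem volume_convexHull_triangle (a b c : EuclideanSpace ℝ (Fin 2)) :
    volume (convexHull ℝ {a, b, c}) = ENNReal.ofReal (|orient a b c| / 2) := by
  rw [convexHull_triangle_eq_image, Set.image_add_left, measure_preimage_add,
    Measure.addHaar_image_linearMap, volume_unit_triangle, LinearMap.det_toLpLin,
    ← ENNReal.ofReal_mul (abs_nonneg _), Matrix.det_fin_two_of, orient]
  congr 1
  rw [mul_one_div]
  congr 2
  ring

theorem orient_convex_combination {a b x y : EuclideanSpace ℝ (Fin 2)} {k l : ℝ}
    (h : k + l = 1) :
    orient a b (k • x + l • y) = k * orient a b x + l * orient a b y := by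
  obtain rfl : k = 1 - l := by linarith
  simp [orient]
  ring

theorem orient_nonneg_of_mem_convexHull {a b x : EuclideanSpace ℝ (Fin 2)}
    {S : Set (EuclideanSpace ℝ (Fin 2))} (hS : ∀ y ∈ S, 0 ≤ orient a b y)
    (hx : x ∈ convexHull ℝ S) : 0 ≤ orient a b x := by
  refine convexHull_min (t := {y | 0 ≤ orient a b y}) hS ?_ hx
  intro x hx y hy k l hk hl hkl
  rw [Set.mem_ofPred_eq] at hx hy ⊢
  rw [orient_convex_combination hkl]
  positivity

theorem orient_swap (a b c : EuclideanSpace ℝ (Fin 2)) : orient b a c = -orient a b c := by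
  simp only [orient]; ring

theorem orient_rotate (a b c : EuclideanSpace ℝ (Fin 2)) : orient b c a = orient a b c := by
  simp only [orient]; ring

theorem volume_orient_eq_zero {a b : EuclideanSpace ℝ (Fin 2)} (hab : a ≠ b) :
    volume {x | orient a b x = 0} = 0 := by
  let f : EuclideanSpace ℝ (Fin 2) →ₗ[ℝ] ℝ :=
    { toFun := fun x => (b 0 - a 0) * x 1 - (b 1 - a 1) * x 0
      map_add' := fun x y => by simp; ring
      map_smul' := fun k x => by simp; ring }
  have hf : LinearMap.ker f ≠ ⊤ := by
    intro h
    apply hab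
    have h0 : f (!₂[1, 0]) = 0 := by rw [LinearMap.ker_eq_top.1 h]; rfl
    have h1 : f (!₂[0, 1]) = 0 := by rw [LinearMap.ker_eq_top.1 h]; rfl
    simp [f] at h0 h1
    ext i
    fin_cases i
    · change a 0 = b 0; linarith
    · change a 1 = b 1; linarith
  have : {x | orient a b x = 0} = (fun x => -a + x) ⁻¹' (LinearMap.ker f : Set _) := by
    ext x
    simp only [Set.mem_ofPred_eq, Set.mem_preimage, SetLike.mem_coe, LinearMap.mem_ker]
    simp [f, orient, sub_eq_add_neg, add_comm]
  rw [this, measure_preimage_add]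
  exact Measure.addHaar_submodule _ _ hf

/-- Cutting a convex hull along the segment `a b` that separates the new point `x` from `S`. -/
theorem convexHull_insert_eq_union {S : Set (EuclideanSpace ℝ (Fin 2))}
    {a b x : EuclideanSpace ℝ (Fin 2)} (ha : a ∈ S) (hb : b ∈ S)
    (hx : 0 < orient a b x) (hS : ∀ y ∈ S, 0 ≤ orient x a y) (hS' : ∀ y ∈ S, 0 ≤ orient b x y)
    (hS'' : ∀ y ∈ S, 0 ≤ orient b a y) :
    convexHull ℝ (insert x S) = convexHull ℝ S ∪ convexHull ℝ {a, b, x} := by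
  apply Set.Subset.antisymm
  · intro z hz
    rw [convexHull_insert ⟨a, ha⟩, convexJoin_singleton_left, Set.mem_iUnion₂] at hz
    obtain ⟨y, hy, k, l, hk, hl, hkl, rfl⟩ := hz
    have h1 := orient_nonneg_of_mem_convexHull hS hy
    have h2 := orient_nonneg_of_mem_convexHull hS' hy
    have h3 := orient_nonneg_of_mem_convexHull hS'' hy
    have hD : (orient b x y + orient x a y) - orient a b x = orient b a y := by
      simp only [orient]; ring
    have hpos : 0 < orient b x y + orient x a y := by linarith
    set A := orient b x y with hA
    set B := orient x a y with hB
    set D := orient a b x with hDdef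
    have hbary : (A / (A + B)) • a + (B / (A + B)) • b
        = (D / (A + B)) • y + (1 - D / (A + B)) • x := by
      ext i
      simp only [PiLp.add_apply, PiLp.smul_apply, smul_eq_mul]
      field_simp
      fin_cases i <;> simp only [hA, hB, hDdef, orient] <;> simp <;> ring
    have hτ0 : 0 < D / (A + B) := by positivity
    have hτ1 : D / (A + B) ≤ 1 := by rw [div_le_one hpos]; linarith
    set τ := D / (A + B) with hτ
    set w := (A / (A + B)) • a + (B / (A + B)) • b with hw
    have hab : A / (A + B) + B / (A + B) = 1 := by field_simp
    have hw_mem : ∀ C : Set (EuclideanSpace ℝ (Fin 2)), Convex ℝ C → a ∈ C → b ∈ C → w ∈ C :=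
      fun C hC haC hbC => hC haC hbC (by positivity) (by positivity) hab
    rcases le_or_gt l τ with hl' | hl'
    · right
      have hwT := hw_mem _ (convex_convexHull ℝ {a, b, x})
        (subset_convexHull ℝ _ (by simp)) (subset_convexHull ℝ _ (by simp))
      have hxT : x ∈ convexHull ℝ {a, b, x} := subset_convexHull ℝ _ (by simp)
      convert! convex_convexHull ℝ {a, b, x} hxT hwT (a := 1 - l / τ) (b := l / τ)
        (by rw [sub_nonneg, div_le_one hτ0]; exact hl') (by positivity) (by ring) using 1
      rw [hbary]
      obtain rfl : k = 1 - l := by linarith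
      ext i
      simp only [PiLp.add_apply, PiLp.smul_apply, smul_eq_mul]
      field_simp
      ring
    · left
      have hwS := hw_mem _ (convex_convexHull ℝ S)
        (subset_convexHull ℝ _ ha) (subset_convexHull ℝ _ hb)
      have hτ1' : 0 < 1 - τ := by linarith
      convert! convex_convexHull ℝ S hwS hy (a := k / (1 - τ)) (b := 1 - k / (1 - τ))
        (by positivity) (by rw [sub_nonneg, div_le_one hτ1']; linarith) (by ring) using 1
      rw [hbary]
      obtain rfl : k = 1 - l := by linarith
      ext i
      simp only [PiLp.add_apply, PiLp.smul_apply, smul_eq_mul]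
      field_simp
      ring
  · refine Set.union_subset (convexHull_mono (Set.subset_insert _ _)) (convexHull_mono ?_)
    rintro y (rfl | rfl | rfl)
    · exact .inr ha
    · exact .inr hb
    · exact .inl rfl

/-- The area of a convex polygon is the sum of the areas of the triangles of its fan
triangulation. -/
theorem volume_convexHull_polygon (Q : ℕ → EuclideanSpace ℝ (Fin 2)) {n : ℕ} (hn : 1 ≤ n)
    (h : ∀ i j k, i < j → j < k → k ≤ n + 1 → 0 < orient (Q i) (Q j) (Q k)) :
    volume (convexHull ℝ (Q '' Set.Iic (n + 1))) = ENNReal.ofReal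
      (orient (Q 0) (Q 1) (Q 2) / 2
        + ∑ q ∈ Finset.Icc 2 n, orient (Q 0) (Q q) (Q (q + 1)) / 2) := by
  induction n, hn using Nat.le_induction with
  | base =>
    have hset : Q '' Set.Iic (1 + 1) = {Q 0, Q 1, Q 2} := by
      have : Set.Iic (1 + 1) = ({0, 1, 2} : Set ℕ) := by
        ext i
        simp only [Set.mem_Iic, Set.mem_insert_iff, Set.mem_singleton_iff]
        omega
      rw [this, Set.image_insert_eq, Set.image_pair]
    rw [hset, volume_convexHull_triangle,
      abs_of_pos (h 0 1 2 (by norm_num) (by norm_num) (by norm_num))]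
    simp
  | succ n hn ih =>
    have hset : Q '' Set.Iic (n + 1 + 1) = insert (Q (n + 2)) (Q '' Set.Iic (n + 1)) := by
      rw [← Set.image_insert_eq]
      congr 1
      ext i
      simp only [Set.mem_Iic, Set.mem_insert_iff]
      omega
    have hpos := h 0 (n + 1) (n + 2) (by omega) (by omega) le_rfl
    have hside : ∀ y ∈ Q '' Set.Iic (n + 1), 0 ≤ orient (Q (n + 1)) (Q 0) y := by
      rintro _ ⟨i, hi, rfl⟩
      rw [Set.mem_Iic] at hi
      rw [← orient_rotate]
      rcases Nat.eq_zero_or_pos i with rfl | hi0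
      · simp [orient]
      rcases hi.eq_or_lt with rfl | hi'
      · simp [orient, mul_comm]
      exact (h 0 i (n + 1) hi0 hi' (by omega)).le
    rw [hset, convexHull_insert_eq_union (a := Q 0) (b := Q (n + 1))
      (Set.mem_image_of_mem Q (by simp)) (Set.mem_image_of_mem Q (by simp)) hpos ?_ ?_ hside, measure_union₀, ih, volume_convexHull_triangle,
      abs_of_pos hpos, ← ENNReal.ofReal_add, Finset.sum_Icc_succ_top (by omega), add_assoc]
    · have := h 0 1 2 (by norm_num) (by norm_num) (by omega)
      refine add_nonneg (by positivity) (Finset.sum_nonneg fun q hq => ?_)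
      rw [Finset.mem_Icc] at hq
      have := h 0 q (q + 1) (by omega) (by omega) (by omega)
      positivity
    · positivity
    · exact fun i j k hij hjk hk => h i j k hij hjk (by omega)
    · exact ((Set.toFinite {Q 0, Q (n + 1), Q (n + 2)}).isCompact_convexHull
        (𝕜 := ℝ)).measurableSet.nullMeasurableSet
    · have hne : Q 0 ≠ Q (n + 1) := by
        intro heq
        simp [heq, orient] at hpos
      refine measure_mono_null (fun z hz => ?_) (volume_orient_eq_zero hne)
      have h1 := orient_nonneg_of_mem_convexHull hside hz.1
      have h2 : 0 ≤ orient (Q 0) (Q (n + 1)) z := by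
        refine orient_nonneg_of_mem_convexHull ?_ hz.2
        rintro y (rfl | rfl | rfl)
        · simp [orient]
        · simp [orient, mul_comm]
        · exact hpos.le
      rw [orient_swap] at h1
      exact le_antisymm (by linarith) h2
    · rintro _ ⟨i, hi, rfl⟩
      rw [Set.mem_Iic] at hi
      rw [← orient_rotate]
      rcases Nat.eq_zero_or_pos i with rfl | hi0
      · simp [orient]
      exact (h 0 i (n + 2) hi0 (by omega) le_rfl).le
    · rintro _ ⟨i, hi, rfl⟩
      rw [Set.mem_Iic] at hi
      rw [orient_rotate]
      rcases hi.eq_or_lt with rfl | hi'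
      · simp [orient]
      exact (h i (n + 1) (n + 2) hi' (by omega) le_rfl).le

theorem orient_of_circle {a b c O : EuclideanSpace ℝ (Fin 2)} {ρ α β γ : ℝ}
    (ha : a 0 = O 0 + ρ * cos α ∧ a 1 = O 1 + ρ * sin α)
    (hb : b 0 = O 0 + ρ * cos β ∧ b 1 = O 1 + ρ * sin β)
    (hc : c 0 = O 0 + ρ * cos γ ∧ c 1 = O 1 + ρ * sin γ) :
    orient a b c = 4 * ρ ^ 2 * sin ((β - α) / 2) * sin ((γ - β) / 2) * sin ((γ - α) / 2) := by
  have key : orient a b c = ρ ^ 2 * ((cos β - cos α) * (sin γ - sin α)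
      - (sin β - sin α) * (cos γ - cos α)) := by
    rw [orient, ha.1, ha.2, hb.1, hb.2, hc.1, hc.2]
    ring
  have hγβ : sin ((γ - β) / 2) = sin ((γ + α) / 2 - (β + α) / 2) := by ring_nf
  rw [key, hγβ, sin_sub, cos_sub_cos, cos_sub_cos, sin_sub_sin, sin_sub_sin]
  ring

theorem dist_of_circle {a b O : EuclideanSpace ℝ (Fin 2)} {ρ α β : ℝ}
    (ha : a 0 = O 0 + ρ * cos α ∧ a 1 = O 1 + ρ * sin α)
    (hb : b 0 = O 0 + ρ * cos β ∧ b 1 = O 1 + ρ * sin β)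
    (hnonneg : 0 ≤ 2 * ρ * sin ((β - α) / 2)) :
    dist a b = 2 * ρ * sin ((β - α) / 2) := by
  rw [EuclideanSpace.dist_eq, Fin.sum_univ_two, ← Real.sqrt_sq hnonneg]
  congr 1
  have h0 : b 0 - a 0 = ρ * (cos β - cos α) := by rw [ha.1, hb.1]; ring
  have h1 : b 1 - a 1 = ρ * (sin β - sin α) := by rw [ha.2, hb.2]; ring
  rw [dist_comm, Real.dist_eq, sq_abs, dist_comm, Real.dist_eq, sq_abs, h0, h1, cos_sub_cos,
    sin_sub_sin]
  linear_combination (4 * ρ ^ 2 * sin ((β - α) / 2) ^ 2) * sin_sq_add_cos_sq ((β + α) / 2)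

theorem sin_two_mul_add_add (u v : ℝ) :
    sin (2 * u) + sin (2 * (v - u)) + sin (2 * v) = 4 * cos (v - u) * sin v * cos u := by
  simp only [sin_two_mul, sin_sub, cos_sub]
  linear_combination (-2 * sin v * cos v) * sin_sq_add_cos_sq u
    + (-2 * sin u * cos u) * sin_sq_add_cos_sq v

theorem sin_two_mul_sub_add (u v : ℝ) :
    sin (2 * u) - sin (2 * (v - u)) + sin (2 * v) = 4 * cos (v - u) * sin u * cos v := by
  simp only [sin_two_mul, sin_sub, cos_sub]
  linear_combination (-2 * sin v * cos v) * sin_sq_add_cos_sq u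
    + (-2 * sin u * cos u) * sin_sq_add_cos_sq v

theorem sin_two_mul_add_sub (u v : ℝ) :
    sin (2 * u) + sin (2 * (v - u)) - sin (2 * v) = 4 * sin (v - u) * sin u * sin v := by
  simp only [sin_two_mul, sin_sub, cos_sub]
  linear_combination (2 * sin v * cos v) * sin_sq_add_cos_sq u
    + (-2 * sin u * cos u) * sin_sq_add_cos_sq v

theorem neg_sin_two_mul_add_add (u v : ℝ) :
    -sin (2 * u) + sin (2 * (v - u)) + sin (2 * v) = 4 * sin (v - u) * cos u * cos v := by
  simp only [sin_two_mul, sin_sub, cos_sub]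
  linear_combination (-2 * sin v * cos v) * sin_sq_add_cos_sq u
    + (2 * sin u * cos u) * sin_sq_add_cos_sq v

/-- Area formula for convex cyclic polygons: the square of the area of a convex
cyclic polygon with `n+2` vertices is a symmetric function of the tangent
lengths of the triangles of a fan triangulation. -/
theorem cyclic_polygon_area_formula
    (n : ℕ) (hn : 1 ≤ n)
    (Q : ℕ → EuclideanSpace ℝ (Fin 2))
    (O : EuclideanSpace ℝ (Fin 2)) (ρ : ℝ) (θ : ℕ → ℝ)
    (hρ : 0 < ρ)
    (hθmem : ∀ i ≤ n + 1, θ i ∈ Set.Ico 0 (2 * π))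
    (hθmono : StrictMonoOn θ (Set.Iic (n + 1)))
    (hQ : ∀ i ≤ n + 1,
      Q i 0 = O 0 + ρ * Real.cos (θ i) ∧ Q i 1 = O 1 + ρ * Real.sin (θ i))
    (hinj : ∀ i ≤ n + 1, ∀ j ≤ n + 1, Q i = Q j → i = j)
    (p s r t : ℕ → ℝ)
    (hp : ∀ j, 1 ≤ j → j ≤ n →
      p j = (dist (Q 0) (Q j) + dist (Q j) (Q (j + 1)) + dist (Q (j + 1)) (Q 0)) / 2)
    (hs : ∀ j, 1 ≤ j → j ≤ n → s j = p j - dist (Q j) (Q (j + 1)))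
    (hr : ∀ j, 1 ≤ j → j ≤ n → r j = p j - dist (Q 0) (Q (j + 1)))
    (ht : ∀ j, 1 ≤ j → j ≤ n → t j = p j - dist (Q 0) (Q j)) :
    (volume (convexHull ℝ (Q '' Set.Iic (n + 1)))).toReal ^ 2
      = (p 1 * r 1 + ∑ q ∈ Finset.Icc 2 n, r q * s q * ∏ m ∈ Finset.Icc 2 (q - 1), s m / p m)
        * (s 1 * t 1 + ∑ q ∈ Finset.Icc 2 n, p q * t q * ∏ m ∈ Finset.Icc 2 (q - 1), p m / s m) := by
  have hlt : ∀ i j, i < j → j ≤ n + 1 → θ i < θ j := fun i j hij hj =>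
    hθmono (Set.mem_Iic.2 (by omega)) (Set.mem_Iic.2 hj) hij
  have hsin : ∀ i j, i < j → j ≤ n + 1 → 0 < sin ((θ j - θ i) / 2) := fun i j hij hj => by
    have h1 := hlt i j hij hj
    have h2 := (hθmem i (by omega)).1
    have h3 := (hθmem j hj).2
    exact sin_pos_of_pos_of_lt_pi (by linarith) (by linarith)
  have horient : ∀ i j k, i < j → j < k → k ≤ n + 1 → 0 < orient (Q i) (Q j) (Q k) :=
    fun i j k hij hjk hk => by
      rw [orient_of_circle (hQ i (by omega)) (hQ j (by omega)) (hQ k hk)]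
      have h1 := hsin i j hij (by omega)
      have h2 := hsin j k hjk hk
      have h3 := hsin i k (by omega) hk
      positivity
  have hdist : ∀ i j, i < j → j ≤ n + 1 → dist (Q i) (Q j) = 2 * ρ * sin ((θ j - θ i) / 2) :=
    fun i j hij hj => dist_of_circle (hQ i (by omega)) (hQ j hj) (by
      have := hsin i j hij hj
      positivity)
  let x : ℕ → ℝ := fun i => (θ i - θ 0) / 4
  have hxmem : ∀ i, 1 ≤ i → i ≤ n + 1 → 0 < x i ∧ x i < π / 2 := fun i hi hi' => by
    have h1 := hlt 0 i hi hi'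
    have h2 := (hθmem 0 (by omega)).1
    have h3 := (hθmem i hi').2
    constructor <;> simp only [x] <;> linarith
  have hsinx : ∀ i, 1 ≤ i → i ≤ n + 1 → 0 < sin (x i) := fun i hi hi' =>
    sin_pos_of_pos_of_lt_pi (hxmem i hi hi').1 (by linarith [(hxmem i hi hi').2, pi_pos])
  have hcosx : ∀ i, 1 ≤ i → i ≤ n + 1 → 0 < cos (x i) := fun i hi hi' =>
    cos_pos_of_mem_Ioo ⟨by linarith [(hxmem i hi hi').1, pi_pos], (hxmem i hi hi').2⟩
  have hcosδ : ∀ j, 1 ≤ j → j ≤ n → 0 < cos (x (j + 1) - x j) := fun j hj hj' => by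
    have h1 := hxmem j hj (by omega)
    have h2 := hxmem (j + 1) (by omega) (by omega)
    exact cos_pos_of_mem_Ioo ⟨by linarith, by linarith⟩
  have hd0 : ∀ i, 1 ≤ i → i ≤ n + 1 → dist (Q 0) (Q i) = 2 * ρ * sin (2 * x i) :=
    fun i hi hi' => by
      rw [hdist 0 i hi hi', show (θ i - θ 0) / 2 = 2 * x i by simp only [x]; ring]
  have hd1 : ∀ j, 1 ≤ j → j ≤ n →
      dist (Q j) (Q (j + 1)) = 2 * ρ * sin (2 * (x (j + 1) - x j)) := fun j hj hj' => by
    rw [hdist j (j + 1) (by omega) (by omega),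
      show (θ (j + 1) - θ j) / 2 = 2 * (x (j + 1) - x j) by simp only [x]; ring]
  have hp' : ∀ j, 1 ≤ j → j ≤ n →
      p j = 4 * ρ * cos (x (j + 1) - x j) * sin (x (j + 1)) * cos (x j) := fun j hj hj' => by
    rw [hp j hj hj', hd0 j hj (by omega), dist_comm (Q (j + 1)), hd0 (j + 1) (by omega) (by omega),
      hd1 j hj hj']
    linear_combination ρ * sin_two_mul_add_add (x j) (x (j + 1))
  have hs' : ∀ j, 1 ≤ j → j ≤ n →
      s j = 4 * ρ * cos (x (j + 1) - x j) * sin (x j) * cos (x (j + 1)) := fun j hj hj' => by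
    rw [hs j hj hj', hp' j hj hj', hd1 j hj hj']
    linear_combination ρ * sin_two_mul_sub_add (x j) (x (j + 1))
      - ρ * sin_two_mul_add_add (x j) (x (j + 1))
  have hr' : ∀ j, 1 ≤ j → j ≤ n →
      r j = 4 * ρ * sin (x (j + 1) - x j) * sin (x j) * sin (x (j + 1)) := fun j hj hj' => by
    rw [hr j hj hj', hp' j hj hj', hd0 (j + 1) (by omega) (by omega)]
    linear_combination ρ * sin_two_mul_add_sub (x j) (x (j + 1))
      - ρ * sin_two_mul_add_add (x j) (x (j + 1))
  have ht' : ∀ j, 1 ≤ j → j ≤ n →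
      t j = 4 * ρ * sin (x (j + 1) - x j) * cos (x j) * cos (x (j + 1)) := fun j hj hj' => by
    rw [ht j hj hj', hp' j hj hj', hd0 j hj (by omega)]
    linear_combination ρ * neg_sin_two_mul_add_add (x j) (x (j + 1))
      - ρ * sin_two_mul_add_add (x j) (x (j + 1))
  have harea : ∀ j, 1 ≤ j → j ≤ n → orient (Q 0) (Q j) (Q (j + 1)) / 2
      = 16 * ρ ^ 2 * (sin (x j) * cos (x j)) * (sin (x (j + 1)) * cos (x (j + 1)))
        * (sin (x (j + 1) - x j) * cos (x (j + 1) - x j)) := fun j hj hj' => by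
    rw [orient_of_circle (hQ 0 (by omega)) (hQ j (by omega)) (hQ (j + 1) (by omega)),
      show (θ j - θ 0) / 2 = 2 * x j by simp only [x]; ring,
      show (θ (j + 1) - θ j) / 2 = 2 * (x (j + 1) - x j) by simp only [x]; ring,
      show (θ (j + 1) - θ 0) / 2 = 2 * x (j + 1) by simp only [x]; ring,
      sin_two_mul, sin_two_mul, sin_two_mul]
    ring
  have hprod : ∀ q, 2 ≤ q → q ≤ n → ∏ m ∈ Finset.Icc 2 (q - 1), s m / p m
      = (sin (x 2) / cos (x 2)) / (sin (x q) / cos (x q)) := by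
    intro q hq
    induction q, hq using Nat.le_induction with
    | base =>
      intro h2
      have h1 := hsinx 2 (by omega) (by omega)
      have h3 := hcosx 2 (by omega) (by omega)
      rw [div_self (by positivity)]
      simp
    | succ q hq ih =>
      intro hqn
      have h1 := hsinx 2 (by omega) (by omega)
      have h2 := hcosx 2 (by omega) (by omega)
      have h3 := hsinx q (by omega) (by omega)
      have h4 := hcosx q (by omega) (by omega)
      have h5 := hsinx (q + 1) (by omega) (by omega)
      have h6 := hcosx (q + 1) (by omega) (by omega)
      have h7 := hcosδ q (by omega) (by omega)
      obtain ⟨k, rfl⟩ : ∃ k, q = k + 1 := ⟨q - 1, by omega⟩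
      rw [Nat.add_sub_cancel] at ih ⊢
      rw [Finset.prod_Icc_succ_top (by omega), ih (by omega), hs' _ (by omega) (by omega),
        hp' _ (by omega) (by omega)]
      field_simp
  have hprod' : ∀ q, 2 ≤ q → q ≤ n → ∏ m ∈ Finset.Icc 2 (q - 1), p m / s m
      = (sin (x q) / cos (x q)) / (sin (x 2) / cos (x 2)) := by
    intro q hq hqn
    rw [← inv_div (sin (x 2) / cos (x 2)), ← hprod q hq hqn, ← Finset.prod_inv_distrib]
    simp_rw [inv_div]
  have hsin_two := hsinx 2 (by omega) (by omega)
  have hcos_two := hcosx 2 (by omega) (by omega)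
  set A := orient (Q 0) (Q 1) (Q 2) / 2
    + ∑ q ∈ Finset.Icc 2 n, orient (Q 0) (Q q) (Q (q + 1)) / 2 with hA
  have hA0 : 0 ≤ A := by
    have := horient 0 1 2 (by omega) (by omega) (by omega)
    refine add_nonneg (by positivity) (Finset.sum_nonneg fun q hq => ?_)
    rw [Finset.mem_Icc] at hq
    have := horient 0 q (q + 1) (by omega) (by omega) (by omega)
    positivity
  have hfirst : p 1 * r 1 + ∑ q ∈ Finset.Icc 2 n, r q * s q * ∏ m ∈ Finset.Icc 2 (q - 1), s m / p m
      = sin (x 2) / cos (x 2) * A := by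
    rw [hA, mul_add, Finset.mul_sum]
    congr 1
    · rw [harea 1 le_rfl hn, hp' 1 le_rfl hn, hr' 1 le_rfl hn]
      norm_num only
      field_simp
      ring
    · refine Finset.sum_congr rfl fun q hq => ?_
      rw [Finset.mem_Icc] at hq
      have h3 := hsinx q (by omega) (by omega)
      have h4 := hcosx q (by omega) (by omega)
      rw [hprod q hq.1 hq.2, harea q (by omega) hq.2, hr' q (by omega) hq.2, hs' q (by omega) hq.2]
      field_simp
      ring
  have hsecond :
      s 1 * t 1 + ∑ q ∈ Finset.Icc 2 n, p q * t q * ∏ m ∈ Finset.Icc 2 (q - 1), p m / s m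
        = cos (x 2) / sin (x 2) * A := by
    rw [hA, mul_add, Finset.mul_sum]
    congr 1
    · rw [harea 1 le_rfl hn, hs' 1 le_rfl hn, ht' 1 le_rfl hn]
      norm_num only
      field_simp
      ring
    · refine Finset.sum_congr rfl fun q hq => ?_
      rw [Finset.mem_Icc] at hq
      have h3 := hsinx q (by omega) (by omega)
      have h4 := hcosx q (by omega) (by omega)
      rw [hprod' q hq.1 hq.2, harea q (by omega) hq.2, hp' q (by omega) hq.2, ht' q (by omega) hq.2]
      field_simp
      ring
  rw [hfirst, hsecond, volume_convexHull_polygon Q hn horient, ← hA, ENNReal.toReal_ofReal hA0]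
  field_simp
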